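/- arXiv:1810.02143 — 3 statements merged into one kernel-verified Lean document; each statement's English description precedes it below -/
import Mathlib

section
/- For an even integer n = 2m with m ≥ 2, the group G with presentation ⟨r₀, r₁, r₂ ∣ r₀² = r₁² = r₂² = (r₀r₁)ⁿ = (r₂r₀)² = (r₁r₂)ⁿ = (r₀r₁r₂)² = 1⟩ (the automorphism group of the regular orientable map {n,n}₂) has order 4n. -/
/-- The relations r₀² = r₁² = r₂² = (r₀r₁)ⁿ = (r₂r₀)² = (r₁r₂)ⁿ = (r₀r₁r₂)² = 1
presenting the automorphism group of the regular orientable map {n,n}₂. -/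
def nnRels (n : ℕ) : Set (FreeGroup (Fin 3)) :=
  {FreeGroup.of 0 ^ 2, FreeGroup.of 1 ^ 2, FreeGroup.of 2 ^ 2,
    (FreeGroup.of 0 * FreeGroup.of 1) ^ n,
    (FreeGroup.of 2 * FreeGroup.of 0) ^ 2,
    (FreeGroup.of 1 * FreeGroup.of 2) ^ n,
    (FreeGroup.of 0 * FreeGroup.of 1 * FreeGroup.of 2) ^ 2}

/-- The automorphism group G of the regular orientable map {n,n}₂. -/
abbrev NNGroup (n : ℕ) := PresentedGroup (nnRels n)

/-- The generators rᵢ of G. -/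
def r (n : ℕ) (i : Fin 3) : NNGroup n := PresentedGroup.of i

section

variable {H : Type*} [Group H]

/-- The homomorphism from the cyclic group `ℤ/n` determined by an element whose `n`th power
is trivial. -/
def ofPowEqOne {n : ℕ} (x : H) (hx : x ^ n = 1) : Multiplicative (ZMod n) →* H :=
  AddMonoidHom.toMultiplicativeLeft
    (ZMod.lift n ⟨zmultiplesHom (Additive H) (Additive.ofMul x), by
      simpa [← ofMul_pow] using hx⟩)

theorem ofPowEqOne_intCast {n : ℕ} (x : H) (hx : x ^ n = 1) (k : ℤ) :
    ofPowEqOne x hx (Multiplicative.ofAdd (k : ZMod n)) = x ^ k := by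
  simp [ofPowEqOne, ← ofMul_zpow]

theorem mul_zpow_mul_cancel_left {s t : H} (hs : s * s = 1) (ht : t * t = 1) (k : ℤ) :
    (s * t) ^ k * s = s * (s * t) ^ (-k) := by
  have hs' : s⁻¹ = s := inv_eq_of_mul_eq_one_left hs
  have ht' : t⁻¹ = t := inv_eq_of_mul_eq_one_left ht
  have h : (s * t)⁻¹ = s * (s * t) * s⁻¹ := by
    rw [mul_inv_rev, ht', ← mul_assoc s, hs, one_mul]
  rw [zpow_neg, ← inv_zpow, h, conj_zpow, hs']
  simp only [← mul_assoc, hs, one_mul]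

/-- The homomorphism from the dihedral group determined by two involutions `s` and `t`
with `(s * t) ^ n = 1`. -/
def dihedralLift {n : ℕ} (s t : H) (hs : s * s = 1) (ht : t * t = 1) (hst : (s * t) ^ n = 1) :
    DihedralGroup n →* H where
  toFun
    | .r i => ofPowEqOne (s * t) hst (Multiplicative.ofAdd i)
    | .sr i => s * ofPowEqOne (s * t) hst (Multiplicative.ofAdd i)
  map_one' := map_one (ofPowEqOne (s * t) hst)
  map_mul' := by
    have key (k : ℤ) (x : H) : (s * t) ^ k * (s * x) = s * ((s * t) ^ (-k) * x) := by
      rw [← mul_assoc, mul_zpow_mul_cancel_left hs ht, mul_assoc]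
    rintro (i | i) (j | j) <;> obtain ⟨i, rfl⟩ := ZMod.intCast_surjective i <;>
      obtain ⟨j, rfl⟩ := ZMod.intCast_surjective j <;>
      simp only [DihedralGroup.r_mul_r, DihedralGroup.r_mul_sr, DihedralGroup.sr_mul_r,
        DihedralGroup.sr_mul_sr, ← Int.cast_add, ← Int.cast_sub, ofPowEqOne_intCast, mul_assoc,
        key, ← zpow_add]
    · congr 2
      ring
    · rw [← mul_assoc s s, hs, one_mul]
      congr 1
      ring

theorem dihedralLift_r {n : ℕ} (s t : H) (hs : s * s = 1) (ht : t * t = 1)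
    (hst : (s * t) ^ n = 1) (k : ℤ) : dihedralLift s t hs ht hst (.r k) = (s * t) ^ k :=
  ofPowEqOne_intCast _ hst k

theorem dihedralLift_sr {n : ℕ} (s t : H) (hs : s * s = 1) (ht : t * t = 1)
    (hst : (s * t) ^ n = 1) (k : ℤ) : dihedralLift s t hs ht hst (.sr k) = s * (s * t) ^ k :=
  congrArg (s * ·) (ofPowEqOne_intCast _ hst k)

end

namespace NNGroup

variable {n : ℕ}

theorem r_mul_self (i : Fin 3) : r n i * r n i = 1 := by
  rw [← pow_two]
  refine PresentedGroup.one_of_mem (x := FreeGroup.of i ^ 2) ?_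
  fin_cases i <;> simp [nnRels]

theorem r_zero_mul_r_one_pow : (r n 0 * r n 1) ^ n = 1 :=
  PresentedGroup.one_of_mem (rels := nnRels n) (x := (FreeGroup.of 0 * FreeGroup.of 1) ^ n)
    (by simp [nnRels])

theorem r_two_mul_r_zero_sq : (r n 2 * r n 0) ^ 2 = 1 :=
  PresentedGroup.one_of_mem (rels := nnRels n) (x := (FreeGroup.of 2 * FreeGroup.of 0) ^ 2)
    (by simp [nnRels])

theorem petrie_sq : (r n 0 * r n 1 * r n 2) ^ 2 = 1 :=
  PresentedGroup.one_of_mem (rels := nnRels n)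
    (x := (FreeGroup.of 0 * FreeGroup.of 1 * FreeGroup.of 2) ^ 2) (by simp [nnRels])

theorem r_inv (i : Fin 3) : (r n i)⁻¹ = r n i :=
  inv_eq_of_mul_eq_one_left (r_mul_self i)

theorem r_two_commute_r_zero : Commute (r n 2) (r n 0) := by
  have h := inv_eq_of_mul_eq_one_left ((pow_two _).symm.trans (r_two_mul_r_zero_sq (n := n)))
  rw [mul_inv_rev, r_inv, r_inv] at h
  exact h.symm

theorem r_one_commute : Commute (r n 1) (r n 2 * r n 0) := by
  have h := inv_eq_of_mul_eq_one_left ((pow_two _).symm.trans (petrie_sq (n := n)))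
  simp only [mul_inv_rev, r_inv] at h
  calc r n 1 * (r n 2 * r n 0) = r n 0 * (r n 0 * r n 1 * r n 2) * r n 0 := by
        simp only [← mul_assoc, r_mul_self, one_mul]
    _ = r n 0 * r n 2 * r n 1 * (r n 0 * r n 0) := by rw [← h]; simp only [mul_assoc]
    _ = r n 2 * r n 0 * r n 1 := by rw [r_mul_self, mul_one, r_two_commute_r_zero.eq]

theorem commute_r_two_mul_r_zero (g : NNGroup n) : Commute g (r n 2 * r n 0) := by
  refine (Subgroup.mem_centralizer_singleton_iff.1 <|
    PresentedGroup.generated_by _ (Subgroup.centralizer {r n 2 * r n 0}) (fun j => ?_) g)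
  rw [Subgroup.mem_centralizer_singleton_iff]
  change Commute (r n j) (r n 2 * r n 0)
  fin_cases j
  · exact r_two_commute_r_zero.symm.mul_right (.refl _)
  · exact r_one_commute
  · exact (Commute.refl _).mul_right r_two_commute_r_zero

/-- The images of the generators in the direct product of a dihedral group and a group of
order two. -/
def genImage (n : ℕ) : Fin 3 → DihedralGroup n × Multiplicative (ZMod 2) :=
  ![(.sr 0, 1), (.sr 1, 1), (.sr 0, .ofAdd 1)]

theorem lift_genImage_eq_one (hn : Even n) :
    ∀ x ∈ nnRels n, FreeGroup.lift (genImage n) x = 1 := by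
  have hz : Multiplicative.ofAdd (1 : ZMod 2) ^ n = 1 := by
    obtain ⟨m, rfl⟩ := hn
    rw [← two_mul, pow_mul]
    exact one_pow m
  have hz_sq : Multiplicative.ofAdd (1 : ZMod 2) * Multiplicative.ofAdd 1 = 1 := rfl
  rintro x (rfl | rfl | rfl | rfl | rfl | rfl | rfl) <;>
    simp [genImage, Prod.ext_iff, pow_two _, hz, hz_sq]

/-- The homomorphism to the direct product of a dihedral group and a group of order two. -/
def toProd (hn : Even n) : NNGroup n →* DihedralGroup n × Multiplicative (ZMod 2) :=
  PresentedGroup.toGroup (lift_genImage_eq_one hn)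

theorem toProd_r (hn : Even n) (i : Fin 3) : toProd hn (r n i) = genImage n i :=
  PresentedGroup.toGroup.of _

/-- The homomorphism from the direct product of a dihedral group and a group of order two. -/
def ofProd (n : ℕ) : DihedralGroup n × Multiplicative (ZMod 2) →* NNGroup n :=
  (dihedralLift (r n 0) (r n 1) (r_mul_self 0) (r_mul_self 1) r_zero_mul_r_one_pow).noncommCoprod
    (ofPowEqOne (r n 2 * r n 0) r_two_mul_r_zero_sq) fun g c => by
      obtain ⟨k, hk⟩ := ZMod.intCast_surjective c.toAdd
      rw [← ofAdd_toAdd c, ← hk, ofPowEqOne_intCast]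
      exact (commute_r_two_mul_r_zero _).zpow_right k

theorem ofProd_r (i k : ℤ) : ofProd n (.r i, .ofAdd (k : ZMod 2)) =
    (r n 0 * r n 1) ^ i * (r n 2 * r n 0) ^ k := by
  simp [ofProd, dihedralLift_r, ofPowEqOne_intCast]

theorem ofProd_sr (i k : ℤ) : ofProd n (.sr i, .ofAdd (k : ZMod 2)) =
    r n 0 * (r n 0 * r n 1) ^ i * (r n 2 * r n 0) ^ k := by
  simp [ofProd, dihedralLift_sr, ofPowEqOne_intCast]

theorem ofProd_comp_toProd (hn : Even n) : (ofProd n).comp (toProd hn) = MonoidHom.id _ := by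
  refine PresentedGroup.ext fun i => ?_
  change ofProd n (toProd hn (r n i)) = r n i
  rw [toProd_r]
  fin_cases i
  · simpa [genImage] using ofProd_sr (n := n) 0 0
  · simpa [genImage, ← mul_assoc, r_mul_self] using ofProd_sr (n := n) 1 0
  · simpa [genImage, r_two_commute_r_zero.eq, ← mul_assoc, r_mul_self] using
      ofProd_sr (n := n) 0 1

theorem toProd_comp_ofProd (hn : Even n) : (toProd hn).comp (ofProd n) = MonoidHom.id _ := by
  ext1 ⟨g, c⟩
  obtain ⟨k, hk⟩ := ZMod.intCast_surjective c.toAdd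
  rw [← ofAdd_toAdd c, ← hk]
  obtain i | i := g <;> obtain ⟨i, rfl⟩ := ZMod.intCast_surjective i
  · simp [ofProd_r, toProd_r, genImage, ← ofAdd_zsmul]
  · simp [ofProd_sr, toProd_r, genImage, ← ofAdd_zsmul]

/-- For even `n`, the group is the direct product of the dihedral group generated by `r₀` and
`r₁` and the central subgroup generated by `r₂r₀`. -/
def mulEquivProd (hn : Even n) : NNGroup n ≃* DihedralGroup n × Multiplicative (ZMod 2) :=
  (toProd hn).toMulEquiv (ofProd n) (ofProd_comp_toProd hn) (toProd_comp_ofProd hn)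

end NNGroup

/-- For even `n = 2m` with `m ≥ 2`, the group
`G = ⟨r₀,r₁,r₂ ∣ r₀² = r₁² = r₂² = (r₀r₁)ⁿ = (r₂r₀)² = (r₁r₂)ⁿ = (r₀r₁r₂)² = 1⟩`
has order `4n`. -/
theorem stmt10 (n m : ℕ) (hm : 2 ≤ m) (hn : n = 2 * m) :
    Nat.card (NNGroup n) = 4 * n := by
  rw [Nat.card_congr (NNGroup.mulEquivProd (hn ▸ even_two_mul m)).toEquiv, Nat.card_prod,
    DihedralGroup.nat_card, Nat.card_congr Multiplicative.toAdd, Nat.card_zmod]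
  ring
end

section
/- Let n ≥ 11 with n ≡ 3 (mod 4). Define permutations of {1, 2, …, n}: r₀ = (1,2), and r₁ fixes 1 and maps k ↦ n + 2 − k for 2 ≤ k ≤ n. Then the product r₀r₁ (equal to the permutation (1, n, 2)(3, n−1)(4, n−2)⋯) has order 6 in the symmetric group Sₙ. -/
/-- We identify the set {1, 2, …, n} with `ZMod n` via k ↦ k mod n (so n ↔ 0).
Under this identification, the permutation r₁ = (1)(2,n)(3,n−1)⋯, which fixes 1
and maps k ↦ n + 2 − k for 2 ≤ k ≤ n, is x ↦ 2 − x. -/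
def r1 (n : ℕ) : Equiv.Perm (ZMod n) :=
  ⟨fun x => 2 - x, fun x => 2 - x,
    fun x => sub_sub_cancel 2 x, fun x => sub_sub_cancel 2 x⟩

/-- The permutation r₂ = (1,2)(3,n)(4,n−1)⋯, which interchanges 1 and 2 and maps
k ↦ n + 3 − k for 3 ≤ k ≤ n; under the identification above it is x ↦ 3 − x. -/
def r2 (n : ℕ) : Equiv.Perm (ZMod n) :=
  ⟨fun x => 3 - x, fun x => 3 - x,
    fun x => sub_sub_cancel 3 x, fun x => sub_sub_cancel 3 x⟩

theorem swap_mul_r1_apply (n : ℕ) (x : ZMod n) :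
    (Equiv.swap (1 : ZMod n) 2 * r1 n) x =
      if x = 1 then 2 else if x = 0 then 1 else 2 - x := by
  have h1 : 2 - x = 1 ↔ x = 1 := by constructor <;> intro h <;> linear_combination -h
  have h2 : 2 - x = 2 ↔ x = 0 := by constructor <;> intro h <;> linear_combination -h
  change Equiv.swap (1 : ZMod n) 2 (2 - x) = _
  simp only [Equiv.swap_apply_def, h1, h2]

theorem ZMod.natCast_ne_zero_of_pos_of_lt {n k : ℕ} (hk : 0 < k) (hkn : k < n) :
    (k : ZMod n) ≠ 0 := fun h =>
  Nat.not_dvd_of_pos_of_lt hk hkn ((ZMod.natCast_eq_zero_iff k n).mp h)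

/-- The product r₀r₁ = (1,n,2)(3,n−1)(4,n−2)⋯ has order 6 in Sₙ. -/
theorem stmt16 (n : ℕ) (hn : 11 ≤ n) (hmod : n % 4 = 3) :
    orderOf (Equiv.swap (1 : ZMod n) 2 * r1 n) = 6 := by
  have c1 : (1 : ZMod n) ≠ 0 := by
    exact_mod_cast ZMod.natCast_ne_zero_of_pos_of_lt (n := n) (k := 1) (by omega) (by omega)
  have c2 : (2 : ZMod n) ≠ 0 := by
    exact_mod_cast ZMod.natCast_ne_zero_of_pos_of_lt (n := n) (k := 2) (by omega) (by omega)
  have c3 : (3 : ZMod n) ≠ 0 := by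
    exact_mod_cast ZMod.natCast_ne_zero_of_pos_of_lt (n := n) (k := 3) (by omega) (by omega)
  have c4 : (4 : ZMod n) ≠ 0 := by
    exact_mod_cast ZMod.natCast_ne_zero_of_pos_of_lt (n := n) (k := 4) (by omega) (by omega)
  have hp := swap_mul_r1_apply n
  generalize Equiv.swap (1 : ZMod n) 2 * r1 n = p at hp ⊢
  have p1 : p 1 = 2 := by simp [hp]
  have p0 : p 0 = 1 := by simp [hp, c1.symm]
  have p2 : p 2 = 0 := by
    rw [hp, if_neg (fun h => c1 (by linear_combination h)), if_neg c2, sub_self]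
  have pne (x : ZMod n) (h0 : x ≠ 0) (h1 : x ≠ 1) : p x = 2 - x := by
    rw [hp, if_neg h1, if_neg h0]
  have p3 : p 3 = -1 := by
    rw [pne 3 c3 (fun h => c2 (by linear_combination h))]; ring
  have pm : p (-1) = 3 := by
    rw [pne (-1) (neg_ne_zero.mpr c1) (fun h => c2 (by linear_combination -h))]; ring
  refine orderOf_eq_of_pow_and_pow_div_prime (by norm_num) ?_ ?_
  · ext1 x
    simp only [pow_succ, pow_zero, one_mul, Equiv.Perm.mul_apply, Equiv.Perm.one_apply]
    by_cases h0 : x = 0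
    · simp [h0, p0, p1, p2]
    by_cases h1 : x = 1
    · simp [h1, p0, p1, p2]
    by_cases h2 : x = 2
    · simp [h2, p0, p1, p2]
    have hx : p (p x) = x := by
      rw [pne x h0 h1, pne (2 - x) (fun h => h2 (by linear_combination -h))
        (fun h => h1 (by linear_combination -h))]
      ring
    simp only [hx]
  · intro q hq hdvd h
    have hq' : q = 2 ∨ q = 3 := by
      rcases (Nat.Prime.dvd_mul hq).mp (show q ∣ 2 * 3 from hdvd) with h | h
      · exact .inl ((Nat.prime_dvd_prime_iff_eq hq Nat.prime_two).mp h)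
      · exact .inr ((Nat.prime_dvd_prime_iff_eq hq Nat.prime_three).mp h)
    rcases hq' with rfl | rfl
    · have := congrArg (fun f => f 3) h
      simp [pow_succ, p3, pm] at this
      exact c4 (by linear_combination -this)
    · have := congrArg (fun f => f 1) h
      simp [pow_succ, p1, p2] at this
      exact c1 this.symm
end

section
/- Let n ≥ 11 with n ≡ 3 (mod 4). Define permutations of {1, 2, …, n}: r₀ = (2,3); r₁ fixes 1 and maps k ↦ n + 2 − k for 2 ≤ k ≤ n; r₂ interchanges 1 and 2 and maps k ↦ n + 3 − k for 3 ≤ k ≤ n. Then in Sₙ the products r₁r₂, r₂r₀ and r₀r₁ have orders n, 4 and 4 respectively. (Hence the associated orientable hypermap K of Example 6 has type (n, 4, 4).) -/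
/-- If `s` is an involution and `a`, `b`, `s a`, `s b` are distinct, then `s * swap a b`
has order 4. -/
theorem orderOf_mul_swap_eq_four {α : Type*} [DecidableEq α] {s : Equiv.Perm α} {a b : α}
    (hs : ∀ x, s (s x) = x) (hab : a ≠ b) (haa : s a ≠ a) (hbb : s b ≠ b) (hsab : s a ≠ b) :
    orderOf (s * Equiv.swap a b) = 4 := by
  have hsba : s b ≠ a := fun h => hsab (by rw [← h, hs])
  have hss : s * s = 1 := Equiv.ext hs
  have hsq : (s * Equiv.swap a b) ^ 2 = Equiv.swap (s a) (s b) * Equiv.swap a b := by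
    rw [pow_two]
    nth_rewrite 1 [Equiv.mul_swap_eq_swap_mul]
    rw [mul_assoc, ← mul_assoc s s, hss, one_mul]
  have hdisj : (Equiv.swap (s a) (s b)).Disjoint (Equiv.swap a b) := by
    intro x
    by_cases hxa : x = a
    · left; subst hxa; exact Equiv.swap_apply_of_ne_of_ne haa.symm hsba.symm
    by_cases hxb : x = b
    · left; subst hxb; exact Equiv.swap_apply_of_ne_of_ne hsab.symm hbb.symm
    · right; exact Equiv.swap_apply_of_ne_of_ne hxa hxb
  refine orderOf_eq_prime_pow (p := 2) (n := 1) ?_ ?_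
  · intro h
    rw [pow_one, hsq] at h
    have := Equiv.congr_fun h a
    rw [Equiv.Perm.mul_apply, Equiv.swap_apply_left,
      Equiv.swap_apply_of_ne_of_ne hsab.symm hbb.symm] at this
    exact hab this.symm
  · rw [show 2 ^ (1 + 1) = 2 * 2 from rfl, pow_mul, hsq, hdisj.commute.mul_pow, pow_two, pow_two,
      Equiv.swap_mul_self, Equiv.swap_mul_self, one_mul]

/-- The product `r1 n * r2 n` is translation by `-1` on `ZMod n`, so it has order `n`. -/
theorem orderOf_r1_mul_r2 (n : ℕ) : orderOf (r1 n * r2 n) = n := by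
  have hpow : ∀ (k : ℕ) (x : ZMod n), ((r1 n * r2 n) ^ k) x = x - k := by
    intro k
    induction k with
    | zero => simp
    | succ k ih =>
      intro x
      rw [pow_succ, Equiv.Perm.mul_apply, ih]
      change 2 - (3 - x) - (k : ZMod n) = _
      push_cast
      ring
  refine Nat.dvd_antisymm (orderOf_dvd_of_pow_eq_one ?_) ?_
  · ext x
    simp [hpow]
  · have h := hpow (orderOf (r1 n * r2 n)) 0
    rw [pow_orderOf_eq_one, Equiv.Perm.one_apply, zero_sub, eq_comm, neg_eq_zero] at h
    exact (ZMod.natCast_eq_zero_iff _ _).1 h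

/-- With r₀ = (2,3), the products r₁r₂, r₂r₀ and r₀r₁ have orders n, 4 and 4
respectively in Sₙ (so the associated orientable hypermap has type (n,4,4)). -/
theorem stmt19 (n : ℕ) (hn : 11 ≤ n) (hmod : n % 4 = 3) :
    orderOf (r1 n * r2 n) = n ∧
    orderOf (r2 n * Equiv.swap (2 : ZMod n) 3) = 4 ∧
    orderOf (Equiv.swap (2 : ZMod n) 3 * r1 n) = 4 := by
  have h1 : (1 : ZMod n) ≠ 0 := by
    exact_mod_cast ZMod.natCast_ne_zero_of_pos_of_lt (k := 1) (n := n) (by omega) (by omega)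
  have h2 : (2 : ZMod n) ≠ 0 := by
    exact_mod_cast ZMod.natCast_ne_zero_of_pos_of_lt (k := 2) (n := n) (by omega) (by omega)
  have h3 : (3 : ZMod n) ≠ 0 := by
    exact_mod_cast ZMod.natCast_ne_zero_of_pos_of_lt (k := 3) (n := n) (by omega) (by omega)
  have h4 : (4 : ZMod n) ≠ 0 := by
    exact_mod_cast ZMod.natCast_ne_zero_of_pos_of_lt (k := 4) (n := n) (by omega) (by omega)
  have h23 : (2 : ZMod n) ≠ 3 := fun h => h1 (by linear_combination -h)
  refine ⟨orderOf_r1_mul_r2 n, ?_, ?_⟩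
  · refine orderOf_mul_swap_eq_four (fun x => sub_sub_cancel 3 x) h23 ?_ ?_ ?_
    · change (3 - 2 : ZMod n) ≠ 2
      exact fun h => h1 (by linear_combination -h)
    · change (3 - 3 : ZMod n) ≠ 3
      exact fun h => h3 (by linear_combination -h)
    · change (3 - 2 : ZMod n) ≠ 3
      exact fun h => h2 (by linear_combination -h)
  · rw [← orderOf_inv, mul_inv_rev, Equiv.swap_inv]
    refine orderOf_mul_swap_eq_four (s := (r1 n)⁻¹) (fun x => sub_sub_cancel 2 x) h23 ?_ ?_ ?_
    · change (2 - 2 : ZMod n) ≠ 2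
      exact fun h => h2 (by linear_combination -h)
    · change (2 - 3 : ZMod n) ≠ 3
      exact fun h => h4 (by linear_combination -h)
    · change (2 - 2 : ZMod n) ≠ 3
      exact fun h => h3 (by linear_combination -h)
end
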